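/- arXiv:1609.08861 — 8 statements merged into one kernel-verified Lean document; each statement's English description precedes it below -/
import Mathlib

section
/- Fix a dimension d ≥ 1, a time step Δt > 0, mesh widths Δx_l > 0 (l = 1,…,d), numerical flux functions g_l : ℝ × ℝ → ℝ, and a source grid function q : ℤ^d → ℝ. Let Φ be a solution operator of the implicit scheme as in Theorem 1 (for every grid function u and every j: (Φu)_j = u_j − Σ_{l=1}^d (Δt/Δx_l)(g_l((Φu)_j, (Φu)_{j+e_l}) − g_l((Φu)_{j−e_l}, (Φu)_j)) + Δt·q_j, and Φu is the unique solution for each data u), and assume the monotonicity conditions (18)–(19) hold (equivalently, every g_l is nondecreasing in its first argument and nonincreasing in its second argument). If two grid functions v, w satisfy v_i > w_i for exactly one index i ∈ ℤ^d and v_j = w_j for all j ≠ i, then (Φv)_j ≥ (Φw)_j for every j ∈ ℤ^d. -/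
open Filter Topology

/-- The left-hand side of the implicit scheme on an abelian group `A` with shifts `e l`, the mesh
ratios being absorbed into the fluxes `g l`. -/
noncomputable def scheme {A ι : Type*} [AddCommGroup A] [Fintype ι] (e : ι → A)
    (g : ι → ℝ → ℝ → ℝ) (U : A → ℝ) (j : A) : ℝ :=
  U j + ∑ l, (g l (U j) (U (j + e l)) - g l (U (j - e l)) (U j))

/-- Every data set has exactly one solution. -/
def WellPosed {A ι : Type*} [AddCommGroup A] [Fintype ι] (e : ι → A)
    (g : ι → ℝ → ℝ → ℝ) : Prop :=
  Function.Bijective (scheme e g)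

/-- Nondecreasing in the first argument, nonincreasing in the second. -/
def IsMonotoneFlux (f : ℝ → ℝ → ℝ) : Prop :=
  (∀ b, Monotone fun a => f a b) ∧ ∀ a, Antitone (f a)

section Scheme

variable {A B ι : Type*} [AddCommGroup A] [AddCommGroup B] [Fintype ι]

lemma scheme_const (e : ι → A) (g : ι → ℝ → ℝ → ℝ) (c : ℝ) :
    scheme e g (fun _ => c) = fun _ => c := by
  funext j
  simp [scheme]

lemma scheme_comp (e : ι → A) (g : ι → ℝ → ℝ → ℝ) (π : A →+ B) (U : B → ℝ) :
    scheme e g (U ∘ π) = scheme (π ∘ e) g U ∘ π := by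
  funext j
  simp [scheme]

lemma scheme_add_right (e : ι → A) (g : ι → ℝ → ℝ → ℝ) (U : A → ℝ) (h : A) :
    scheme e g (fun j => U (j + h)) = fun j => scheme e g U (j + h) := by
  funext j
  simp only [scheme, add_right_comm, sub_add_eq_add_sub]

lemma scheme_neg (e : ι → A) (g : ι → ℝ → ℝ → ℝ) (U : A → ℝ) :
    scheme e (fun l a b => -g l (-a) (-b)) (-U) = -scheme e g U := by
  funext j
  simp only [scheme, Pi.neg_apply, neg_neg, neg_add, ← Finset.sum_neg_distrib]
  congr 1
  exact Finset.sum_congr rfl fun l _ => by ring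

lemma scheme_reflect (e : ι → A) (g : ι → ℝ → ℝ → ℝ) (U : A → ℝ) :
    scheme (-e) (fun l a b => -g l b a) U = scheme e g U := by
  funext j
  simp only [scheme, Pi.neg_apply]
  congr 1
  refine Finset.sum_congr rfl fun l _ => ?_
  have h1 : j - -e l = j + e l := sub_neg_eq_add _ _
  have h2 : j + -e l = j - e l := (sub_eq_add_neg _ _).symm
  rw [h1, h2]
  ring

lemma scheme_single (e : ι → A) (g : ι → ℝ → ℝ → ℝ) (l : ι) (he : ∀ m, m ≠ l → e m = 0) :
    scheme (fun _ : Unit => e l) (fun _ => g l) = scheme e g := by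
  funext U j
  simp only [scheme, Finset.univ_unique, Finset.sum_singleton]
  rw [Finset.sum_eq_single l (fun m _ hm => by simp [he m hm]) (by simp)]

lemma WellPosed.neg {e : ι → A} {g : ι → ℝ → ℝ → ℝ} (h : WellPosed e g) :
    WellPosed e fun l a b => -g l (-a) (-b) := by
  have key : scheme e (fun l a b => -g l (-a) (-b)) = Neg.neg ∘ scheme e g ∘ Neg.neg := by
    funext U
    have := scheme_neg e g (-U)
    rwa [neg_neg] at this
  unfold WellPosed
  rw [key]
  exact neg_involutive.bijective.comp (h.comp neg_involutive.bijective)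

lemma IsMonotoneFlux.neg {f : ℝ → ℝ → ℝ} (h : IsMonotoneFlux f) :
    IsMonotoneFlux fun a b => -f (-a) (-b) :=
  ⟨fun _ _ _ hx => neg_le_neg (h.1 _ (neg_le_neg hx)),
    fun _ _ _ hx => neg_le_neg (h.2 _ (neg_le_neg hx))⟩

lemma IsMonotoneFlux.reflect {f : ℝ → ℝ → ℝ} (h : IsMonotoneFlux f) :
    IsMonotoneFlux fun a b => -f b a :=
  ⟨fun _ _ _ hx => neg_le_neg (h.2 _ hx), fun _ _ _ hx => neg_le_neg (h.1 _ hx)⟩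

/-- Solutions inherit the periods of their data. -/
lemma WellPosed.exists_eq_comp {e : ι → A} {g : ι → ℝ → ℝ → ℝ} (h : WellPosed e g)
    {π : A →+ B} (hπ : Function.Surjective π) {U : A → ℝ} {x : B → ℝ}
    (hU : scheme e g U = x ∘ π) : ∃ W : B → ℝ, U = W ∘ π ∧ scheme (π ∘ e) g W = x := by
  have hper : ∀ j k, π j = π k → U j = U k := by
    intro j k hjk
    have hk : π (k - j) = 0 := by simp [hjk]
    have : (fun i => U (i + (k - j))) = U := by
      apply h.1
      rw [scheme_add_right, hU]
      funext i
      simp [hjk]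
    have := congrFun this j
    simp only [add_sub_cancel] at this
    exact this.symm
  have hUW : U = (U ∘ Function.surjInv hπ) ∘ π := by
    funext j
    exact hper _ _ (Function.surjInv_eq hπ _).symm
  refine ⟨U ∘ Function.surjInv hπ, hUW, hπ.injective_comp_right ?_⟩
  change _ ∘ π = x ∘ π
  rw [← scheme_comp, ← hUW, hU]

lemma WellPosed.map {e : ι → A} {g : ι → ℝ → ℝ → ℝ} (h : WellPosed e g)
    {π : A →+ B} (hπ : Function.Surjective π) : WellPosed (π ∘ e) g := by
  constructor
  · intro U V hUV
    apply hπ.injective_comp_right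
    apply h.1
    change scheme e g (U ∘ π) = scheme e g (V ∘ π)
    rw [scheme_comp, scheme_comp]
    exact congrArg (· ∘ π) hUV
  · intro x
    obtain ⟨U, hU⟩ := h.2 (x ∘ π)
    obtain ⟨W, -, hW⟩ := h.exists_eq_comp hπ hU
    exact ⟨W, hW⟩

/-- On a finite group the scheme is inverse isotone. -/
lemma le_of_scheme_le [Fintype B] {e : ι → B} {g : ι → ℝ → ℝ → ℝ}
    (hg : ∀ l, IsMonotoneFlux (g l)) {U V : B → ℝ} (h : scheme e g U ≤ scheme e g V) :
    U ≤ V := by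
  classical
  by_contra hcon
  obtain ⟨j₀, hj₀⟩ : ∃ j, V j < U j := by
    simpa [Pi.le_def] using hcon
  set w : B → ℝ := fun j => if V j < U j then 1 else 0 with hw
  set H : ι → B → ℝ := fun l j => g l (V j) (V (j + e l)) - g l (U j) (U (j + e l)) with hH
  have hdiff : ∀ j, scheme e g V j - scheme e g U j
      = (V j - U j) + ∑ l, (H l j - H l (j - e l)) := by
    intro j
    simp only [scheme, hH, sub_add_cancel]
    rw [add_sub_add_comm, ← Finset.sum_sub_distrib]
    congr 1
    exact Finset.sum_congr rfl fun l _ => by ring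
  have h0 : 0 ≤ ∑ j, w j * (scheme e g V j - scheme e g U j) := by
    refine Finset.sum_nonneg fun j _ => mul_nonneg ?_ (sub_nonneg.2 (h j))
    simp only [hw]
    split_ifs <;> norm_num
  have h1 : ∑ j, w j * (V j - U j) < 0 := by
    refine Finset.sum_neg' (fun j _ => ?_) ⟨j₀, Finset.mem_univ _, ?_⟩
    · simp only [hw]
      split_ifs with hj
      · linarith
      · simp
    · simp only [hw, if_pos hj₀]
      linarith
  have h2 : ∀ l, ∑ j, w j * (H l j - H l (j - e l)) ≤ 0 := by
    intro l
    have hs : ∑ j, w j * H l (j - e l) = ∑ j, w (j + e l) * H l j := by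
      rw [← Equiv.sum_comp (Equiv.addRight (e l))]
      simp
    simp only [mul_sub, Finset.sum_sub_distrib]
    rw [hs, ← Finset.sum_sub_distrib]
    refine Finset.sum_nonpos fun j _ => ?_
    simp only [hw, hH]
    split_ifs with ha hb hb
    · simp
    · have := (hg l).1 (V (j + e l)) ha.le
      have := (hg l).2 (U j) (not_lt.1 hb)
      simp only at *
      linarith
    · have := (hg l).1 (V (j + e l)) (not_lt.1 ha)
      have := (hg l).2 (U j) hb.le
      simp only at *
      linarith
    · simp
  have h3 : ∑ j, w j * (scheme e g V j - scheme e g U j)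
      = ∑ j, w j * (V j - U j) + ∑ l, ∑ j, w j * (H l j - H l (j - e l)) := by
    rw [Finset.sum_comm, ← Finset.sum_add_distrib]
    refine Finset.sum_congr rfl fun j _ => ?_
    rw [hdiff, mul_add, Finset.mul_sum]
  have h4 := Finset.sum_nonpos fun l (_ : l ∈ Finset.univ) => h2 l
  linarith

lemma WellPosed.le_of_periodic [Fintype B] {e : ι → A} {g : ι → ℝ → ℝ → ℝ}
    (h : WellPosed e g) (hg : ∀ l, IsMonotoneFlux (g l)) {π : A →+ B}
    (hπ : Function.Surjective π) {U V : A → ℝ} {x y : B → ℝ}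
    (hU : scheme e g U = x ∘ π) (hV : scheme e g V = y ∘ π) (hxy : x ≤ y) : U ≤ V := by
  obtain ⟨U', rfl, rfl⟩ := h.exists_eq_comp hπ hU
  obtain ⟨V', rfl, rfl⟩ := h.exists_eq_comp hπ hV
  exact fun j => le_of_scheme_le hg hxy (π j)

/-- Locally bounded solutions depend continuously on their data. -/
lemma WellPosed.tendsto {e : ι → A} {g : ι → ℝ → ℝ → ℝ} (h : WellPosed e g)
    (hc : ∀ l, Continuous fun p : ℝ × ℝ => g l p.1 p.2) {un : ℕ → A → ℝ} {Un : ℕ → A → ℝ}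
    {U : A → ℝ} (hUn : ∀ n, scheme e g (Un n) = un n)
    (hlim : Tendsto un atTop (𝓝 (scheme e g U)))
    (hbd : ∀ j, ∃ a b, ∀ n, Un n j ∈ Set.Icc a b) : Tendsto Un atTop (𝓝 U) := by
  choose a b hab using hbd
  have hcont : Continuous (scheme e g) := by
    refine continuous_pi fun j => ?_
    refine (continuous_apply j).add (continuous_finsetSum _ fun l _ => ?_)
    have h1 : Continuous fun U : A → ℝ => g l (U j) (U (j + e l)) :=
      Continuous.comp (hc l) (f := fun U : A → ℝ => (U j, U (j + e l)))
        ((continuous_apply j).prodMk (continuous_apply (j + e l)))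
    have h2 : Continuous fun U : A → ℝ => g l (U (j - e l)) (U j) :=
      Continuous.comp (hc l) (f := fun U : A → ℝ => (U (j - e l), U j))
        ((continuous_apply (j - e l)).prodMk (continuous_apply j))
    exact h1.sub h2
  have hK := isCompact_univ_pi fun j => isCompact_Icc (a := a j) (b := b j)
  refine hK.tendsto_nhds_of_unique_mapClusterPt
    (Eventually.of_forall fun n j _ => hab j n) fun W _ hW => ?_
  obtain ⟨F, hF, hFW⟩ := mapClusterPt_iff_ultrafilter.1 hW
  apply h.1
  refine tendsto_nhds_unique ((hcont.tendsto W).comp hFW) ?_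
  refine (hlim.mono_left hF).congr fun n => (hUn n).symm

end Scheme

/-- Data of period two in a coordinate direction see every jump of the flux. -/
lemma continuous_of_wellPosed_zmod_two {f : ℝ → ℝ → ℝ} (hf : IsMonotoneFlux f)
    (h : WellPosed (fun _ : Unit => (1 : ZMod 2)) fun _ => f) :
    Continuous fun p : ℝ × ℝ => f p.1 p.2 := by
  have hcont : ∀ s, Continuous fun x => x + (f x (s - x) - f (s - x) x) := by
    intro s
    refine Monotone.continuous_of_surjective ?_ ?_
    · intro x y hxy
      have h1 := hf.1 (s - x) hxy
      have h2 := hf.2 y (sub_le_sub_left hxy s)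
      have h3 := hf.1 x (sub_le_sub_left hxy s)
      have h4 := hf.2 (s - y) hxy
      simp only at *
      linarith
    · intro y
      obtain ⟨U, hU⟩ := h.2 fun j => if j = 0 then y else s - y
      have h0 := congrFun hU 0
      have h1 := congrFun hU 1
      have e1 : (1 + 1 : ZMod 2) = 0 := by decide
      have e2 : (0 - 1 : ZMod 2) = 1 := by decide
      simp [scheme, e1, e2] at h0 h1
      refine ⟨U 0, ?_⟩
      have : s - U 0 = U 1 := by linarith
      simp only [this]
      linarith
  rw [continuous_iff_continuousAt]
  rintro ⟨a, b⟩
  rw [Metric.continuousAt_iff]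
  intro ε hε
  obtain ⟨δ, hδ, hδε⟩ := Metric.continuousAt_iff.1 ((hcont (a + b)).continuousAt (x := a)) ε hε
  refine ⟨δ / 2, by positivity, ?_⟩
  rintro ⟨x, y⟩ hxy
  rw [Prod.dist_eq, max_lt_iff, Real.dist_eq, Real.dist_eq, abs_lt, abs_lt] at hxy
  obtain ⟨⟨hx1, hx2⟩, hy1, hy2⟩ := hxy
  simp only at hx1 hx2 hy1 hy2
  have hp := @hδε (a + δ / 2) (by rw [Real.dist_eq, abs_lt]; constructor <;> linarith)
  have hm := @hδε (a - δ / 2) (by rw [Real.dist_eq, abs_lt]; constructor <;> linarith)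
  rw [Real.dist_eq, abs_lt] at hp hm
  have e1 : a + b - (a + δ / 2) = b - δ / 2 := by ring
  have e2 : a + b - (a - δ / 2) = b + δ / 2 := by ring
  have e3 : a + b - a = b := by ring
  simp only [e1, e2, e3] at hp hm
  have up1 := hf.1 y (show x ≤ a + δ / 2 by linarith)
  have up2 := hf.2 (a + δ / 2) (show b - δ / 2 ≤ y by linarith)
  have dn1 := hf.1 y (show a - δ / 2 ≤ x by linarith)
  have dn2 := hf.2 (a - δ / 2) (show y ≤ b + δ / 2 by linarith)
  have pp1 := hf.1 a (show b - δ / 2 ≤ b + δ / 2 by linarith)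
  have q1 := hf.1 (a + δ / 2) (show b - δ / 2 ≤ b by linarith)
  have q2 := hf.2 b (show a ≤ a + δ / 2 by linarith)
  have q3 := hf.1 (a - δ / 2) (show b ≤ b + δ / 2 by linarith)
  have q4 := hf.2 b (show a - δ / 2 ≤ a by linarith)
  simp only at *
  rw [Real.dist_eq, abs_lt]
  constructor <;> linarith

/-- For a flux unbounded above in its first argument, two grid functions can be modified on the
negative half-line so that they solve the scheme with the same data there. -/
lemma exists_extension_left {f : ℝ → ℝ → ℝ} (hc : ∀ b, Continuous fun a => f a b)
    (hun : ∀ b C, ∃ a, C < f a b) (V M : ℤ → ℝ) :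
    ∃ V' M' : ℤ → ℝ, (∀ j, 0 ≤ j → V' j = V j) ∧ (∀ j, 0 ≤ j → M' j = M j) ∧
      ∀ j ≤ 0, scheme (fun _ : Unit => (1 : ℤ)) (fun _ => f) V' j
        = scheme (fun _ : Unit => (1 : ℤ)) (fun _ => f) M' j := by
  have hivt : ∀ b x₀ c, f x₀ b ≤ c → ∃ x, f x b = c := by
    intro b x₀ c h
    obtain ⟨a, ha⟩ := hun b c
    exact mem_range_of_exists_le_of_exists_ge (hc b) ⟨x₀, h⟩ ⟨a, ha.le⟩
  have hstep : ∀ v₀ v₁ m₀ m₁ : ℝ, ∃ x y,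
      v₀ + (f v₀ v₁ - f x v₀) = m₀ + (f m₀ m₁ - f y m₀) := by
    intro v₀ v₁ m₀ m₁
    rcases le_total (v₀ + (f v₀ v₁ - f 0 v₀)) (m₀ + (f m₀ m₁ - f 0 m₀)) with h | h
    · obtain ⟨y, hy⟩ := hivt m₀ 0 (m₀ + f m₀ m₁ - (v₀ + (f v₀ v₁ - f 0 v₀))) (by linarith)
      exact ⟨0, y, by linarith⟩
    · obtain ⟨x, hx⟩ := hivt v₀ 0 (v₀ + f v₀ v₁ - (m₀ + (f m₀ m₁ - f 0 m₀))) (by linarith)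
      exact ⟨x, 0, by linarith⟩
  choose X Y hXY using hstep
  let s : ℕ → ℝ × ℝ × ℝ × ℝ := fun n => Nat.rec (V 0, V 1, M 0, M 1)
    (fun _ p => (X p.1 p.2.1 p.2.2.1 p.2.2.2, p.1, Y p.1 p.2.1 p.2.2.1 p.2.2.2, p.2.2.1)) n
  have hs0 : s 0 = (V 0, V 1, M 0, M 1) := rfl
  have hs : ∀ n, s (n + 1) = (X (s n).1 (s n).2.1 (s n).2.2.1 (s n).2.2.2, (s n).1,
      Y (s n).1 (s n).2.1 (s n).2.2.1 (s n).2.2.2, (s n).2.2.1) := fun _ => rfl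
  let V' : ℤ → ℝ := fun j => if 0 ≤ j then V j else (s (-j).toNat).1
  let M' : ℤ → ℝ := fun j => if 0 ≤ j then M j else (s (-j).toNat).2.2.1
  have hV' : ∀ j, 0 ≤ j → V' j = V j := fun j hj => if_pos hj
  have hM' : ∀ j, 0 ≤ j → M' j = M j := fun j hj => if_pos hj
  have hsn : ∀ n : ℕ, s n = (V' (-n), V' (-n + 1), M' (-n), M' (-n + 1)) := by
    intro n
    induction n with
    | zero => simp [hs0, V', M']
    | succ n ih =>
      have hneg : ¬ (0 : ℤ) ≤ -((n + 1 : ℕ) : ℤ) := by omega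
      have h1 : V' (-((n + 1 : ℕ) : ℤ)) = (s (n + 1)).1 := by
        simp only [V', if_neg hneg, neg_neg, Int.toNat_natCast]
      have h2 : M' (-((n + 1 : ℕ) : ℤ)) = (s (n + 1)).2.2.1 := by
        simp only [M', if_neg hneg, neg_neg, Int.toNat_natCast]
      have h3 : -((n + 1 : ℕ) : ℤ) + 1 = -(n : ℤ) := by push_cast; ring
      rw [h1, h2, h3, hs, ih]
  refine ⟨V', M', hV', hM', fun j hj => ?_⟩
  obtain ⟨n, rfl⟩ : ∃ n : ℕ, j = -(n : ℤ) := ⟨(-j).toNat, by omega⟩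
  have h1 := hsn n
  have h2 := hsn (n + 1)
  have h3 : -((n + 1 : ℕ) : ℤ) = -(n : ℤ) - 1 := by push_cast; ring
  rw [hs, h1, h3] at h2
  simp only [Prod.mk.injEq] at h2
  simp only [scheme, Finset.univ_unique, Finset.sum_singleton]
  rw [← h2.1, ← h2.2.2.1]
  exact hXY _ _ _ _

lemma eventually_valMinAbs_eq (j : ℤ) :
    ∀ᶠ n : ℕ in atTop, ((j : ZMod (n + 1))).valMinAbs = j := by
  filter_upwards [eventually_ge_atTop (2 * j.natAbs)] with n hn
  rw [ZMod.valMinAbs_spec]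
  refine ⟨rfl, ?_, ?_⟩ <;> push_cast <;> omega

/-- A well-posed one-dimensional scheme has a flux that is bounded above in its first argument,
for some value of the second. -/
lemma exists_forall_le_of_wellPosed {f : ℝ → ℝ → ℝ} (hf : IsMonotoneFlux f)
    (hc : Continuous fun p : ℝ × ℝ => f p.1 p.2)
    (h : WellPosed (fun _ : Unit => (1 : ℤ)) fun _ => f) : ∃ b C, ∀ a, f a b ≤ C := by
  by_contra! hun
  let u : ℤ → ℝ := fun j => if 1 ≤ j then 0 else 1
  have hu : ∀ j, 0 ≤ u j ∧ u j ≤ 1 := by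
    intro j
    simp only [u]
    split_ifs <;> norm_num
  obtain ⟨U, hU⟩ := h.2 u
  let x : ∀ n : ℕ, ZMod (n + 1) → ℝ := fun n k => u k.valMinAbs
  choose Un hUn using fun n => h.2 (x n ∘ Int.castAddHom (ZMod (n + 1)))
  have hsurj : ∀ n : ℕ, Function.Surjective (Int.castAddHom (ZMod (n + 1))) :=
    fun n => ZMod.intCast_surjective
  have hlow : ∀ n j, 0 ≤ Un n j := fun n =>
    h.le_of_periodic (fun _ => hf) (hsurj n) (U := fun _ => 0) (x := fun _ => 0)
      (scheme_const _ _ _) (hUn n) fun k => (hu _).1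
  have hupp : ∀ n j, Un n j ≤ 1 := fun n =>
    h.le_of_periodic (fun _ => hf) (hsurj n) (V := fun _ => 1) (y := fun _ => 1)
      (hUn n) (scheme_const _ _ _) fun k => (hu _).2
  have hlim : Tendsto Un atTop (𝓝 U) := by
    refine h.tendsto (fun _ => hc) hUn ?_ fun j => ⟨0, 1, fun n => ⟨hlow n j, hupp n j⟩⟩
    rw [hU, tendsto_pi_nhds]
    intro j
    refine tendsto_const_nhds.congr' ?_
    filter_upwards [eventually_valMinAbs_eq j] with n hn
    simp [x, hn]
  have hU0 : ∀ j, 0 ≤ U j := fun j =>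
    ge_of_tendsto' ((tendsto_pi_nhds.1 hlim) j) fun n => hlow n j
  obtain ⟨V', M', hV', hM', hVM⟩ := exists_extension_left
    (fun b => hc.comp (continuous_id.prodMk continuous_const)) hun (fun _ => 0) U
  have heq : V' = M' := by
    apply h.1
    funext j
    rcases le_or_gt j 0 with hj | hj
    · exact hVM j hj
    · have hUj := congrFun hU j
      simp only [scheme, Finset.univ_unique, Finset.sum_singleton, u,
        if_pos (show 1 ≤ j from hj)] at hUj
      simp only [scheme, Finset.univ_unique, Finset.sum_singleton]
      rw [hV' j (by omega), hV' (j + 1) (by omega), hV' (j - 1) (by omega), hM' j (by omega),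
        hM' (j + 1) (by omega), hM' (j - 1) (by omega), hUj]
      simp
  have hUz : ∀ j, 0 ≤ j → U j = 0 := fun j hj => by
    rw [← hM' j hj, ← heq, hV' j hj]
  have h0 := congrFun hU 0
  simp only [scheme, Finset.univ_unique, Finset.sum_singleton, u] at h0
  rw [hUz 0 le_rfl, hUz (0 + 1) (by norm_num)] at h0
  have := hf.1 0 (hU0 (0 - 1))
  norm_num at h0 this
  linarith

section Grid

variable {ι : Type*} [Fintype ι] [DecidableEq ι] {g : ι → ℝ → ℝ → ℝ}

lemma WellPosed.coordinate
    (h : WellPosed (fun l : ι => (Pi.single l 1 : ι → ℤ)) g) (l : ι) {B : Type*}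
    [AddCommGroup B] {π : ℤ →+ B} (hπ : Function.Surjective π) :
    WellPosed (fun _ : Unit => π 1) fun _ => g l := by
  have hs : Function.Surjective (π.comp (Pi.evalAddMonoidHom (fun _ : ι => ℤ) l)) :=
    hπ.comp (Function.surjective_eval l)
  have h1 := h.map hs
  unfold WellPosed at h1 ⊢
  rw [← scheme_single _ g l fun m hm => by simp [Pi.single_eq_of_ne' hm]] at h1
  simpa using h1

lemma WellPosed.continuous_flux (hg : ∀ l, IsMonotoneFlux (g l))
    (h : WellPosed (fun l : ι => (Pi.single l 1 : ι → ℤ)) g) (l : ι) :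
    Continuous fun p : ℝ × ℝ => g l p.1 p.2 := by
  apply continuous_of_wellPosed_zmod_two (hg l)
  simpa using h.coordinate l (π := Int.castAddHom (ZMod 2)) ZMod.intCast_surjective

/-- Solutions are bounded above pointwise in terms of their data. -/
lemma WellPosed.exists_upper_bound (hg : ∀ l, IsMonotoneFlux (g l))
    (h : WellPosed (fun l : ι => (Pi.single l 1 : ι → ℤ)) g) :
    ∃ R C : ℝ, ∀ (U : (ι → ℤ) → ℝ) j,
      U j ≤ max R (scheme (fun l : ι => (Pi.single l 1 : ι → ℤ)) g U j + C) := by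
  have hc := h.continuous_flux hg
  have h1 : ∀ l, ∃ b C, ∀ a, g l a b ≤ C := fun l =>
    exists_forall_le_of_wellPosed (hg l) (hc l)
      (h.coordinate l (π := AddMonoidHom.id ℤ) Function.surjective_id)
  have h2 : ∀ l, ∃ a C, ∀ b, -g l a b ≤ C := by
    intro l
    refine exists_forall_le_of_wellPosed (hg l).reflect
      ((hc l).comp (continuous_snd.prodMk continuous_fst)).neg ?_
    have h3 := h.coordinate l (π := -AddMonoidHom.id ℤ) neg_surjective
    unfold WellPosed at h3 ⊢
    have h4 : scheme (fun _ : Unit => (1 : ℤ)) (fun _ a b => -g l b a)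
        = scheme (fun _ : Unit => (-AddMonoidHom.id ℤ) 1) fun _ => g l := by
      funext U
      rw [← scheme_reflect]
      simp only [neg_neg]
      congr 1
    rwa [h4]
  choose b C hbC using h1
  choose a D haD using h2
  refine ⟨∑ l, (|a l| + |b l|), ∑ l, (C l + D l), fun U j => ?_⟩
  rw [le_max_iff]
  by_contra! hcon
  obtain ⟨hR, hS⟩ := hcon
  have hl : ∀ l, |a l| + |b l| ≤ U j := fun l =>
    (Finset.single_le_sum (f := fun l => |a l| + |b l|) (fun m _ => by positivity)
      (Finset.mem_univ l)).trans hR.le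
  have hsum : 0 ≤ ∑ l, (g l (U j) (U (j + Pi.single l 1)) - g l (U (j - Pi.single l 1)) (U j)
      + (C l + D l)) := by
    refine Finset.sum_nonneg fun l _ => ?_
    have ha : a l ≤ U j := by linarith [hl l, le_abs_self (a l), abs_nonneg (b l)]
    have hb : b l ≤ U j := by linarith [hl l, le_abs_self (b l), abs_nonneg (a l)]
    have h3 := (hg l).1 (U (j + Pi.single l 1)) ha
    have h4 := (hg l).2 (U (j - Pi.single l 1)) hb
    simp only at h3
    linarith [hbC l (U (j - Pi.single l 1)), haD l (U (j + Pi.single l 1))]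
  rw [Finset.sum_add_distrib] at hsum
  simp only [scheme] at hS
  linarith

lemma WellPosed.exists_lower_bound (hg : ∀ l, IsMonotoneFlux (g l))
    (h : WellPosed (fun l : ι => (Pi.single l 1 : ι → ℤ)) g) :
    ∃ R C : ℝ, ∀ (U : (ι → ℤ) → ℝ) j,
      min R (scheme (fun l : ι => (Pi.single l 1 : ι → ℤ)) g U j - C) ≤ U j := by
  obtain ⟨R, C, hRC⟩ := h.neg.exists_upper_bound fun l => (hg l).neg
  refine ⟨-R, C, fun U j => ?_⟩
  have := hRC (-U) j
  rw [scheme_neg, Pi.neg_apply, Pi.neg_apply, le_max_iff] at this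
  rw [min_le_iff]
  rcases this with h | h
  · left; linarith
  · right; linarith

/-- A well-posed monotone conservative scheme on `ℤ^ι` satisfies the comparison principle. -/
theorem WellPosed.comparison (hg : ∀ l, IsMonotoneFlux (g l))
    (h : WellPosed (fun l : ι => (Pi.single l 1 : ι → ℤ)) g) {U V : (ι → ℤ) → ℝ}
    (hUV : scheme (fun l : ι => (Pi.single l 1 : ι → ℤ)) g U
      ≤ scheme (fun l : ι => (Pi.single l 1 : ι → ℤ)) g V) : U ≤ V := by
  let π : ∀ n : ℕ, (ι → ℤ) →+ (ι → ZMod (n + 1)) :=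
    fun n => (Int.castAddHom (ZMod (n + 1))).compLeft ι
  have hπ : ∀ n, Function.Surjective (π n) := fun n =>
    ZMod.intCast_surjective.comp_left
  let per : ((ι → ℤ) → ℝ) → ∀ n : ℕ, (ι → ZMod (n + 1)) → ℝ :=
    fun u _ k => u fun m => (k m).valMinAbs
  have hper : ∀ u, Tendsto (fun n => per u n ∘ π n) atTop (𝓝 u) := by
    intro u
    rw [tendsto_pi_nhds]
    intro j
    refine tendsto_const_nhds.congr' ?_
    filter_upwards [eventually_all.2 fun m => eventually_valMinAbs_eq (j m)] with n hn
    have : (fun m => ((π n j) m).valMinAbs) = j := funext hn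
    simp only [per, Function.comp_apply, this]
  choose S hS using fun u n => h.2 (per u n ∘ π n)
  obtain ⟨R, C, hRC⟩ := h.exists_upper_bound hg
  obtain ⟨R', C', hRC'⟩ := h.exists_lower_bound hg
  have hlim : ∀ W, Tendsto (S (scheme (fun l : ι => (Pi.single l 1 : ι → ℤ)) g W)) atTop
      (𝓝 W) := by
    intro W
    refine h.tendsto (h.continuous_flux hg) (hS _) (hper _) fun j => ?_
    have hj := tendsto_pi_nhds.1 (hper (scheme (fun l : ι => (Pi.single l 1 : ι → ℤ)) g W)) j
    obtain ⟨b, hb⟩ := hj.bddAbove_range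
    obtain ⟨a, ha⟩ := hj.bddBelow_range
    refine ⟨min R' (a - C'), max R (b + C), fun n => ⟨?_, ?_⟩⟩
    · refine (min_le_min_left _ (sub_le_sub_right ?_ _)).trans (hRC' _ j)
      rw [hS]
      exact ha ⟨n, rfl⟩
    · refine (hRC _ j).trans (max_le_max_left _ (add_le_add_left ?_ _))
      rw [hS]
      exact hb ⟨n, rfl⟩
  exact le_of_tendsto_of_tendsto' (hlim U) (hlim V) fun n =>
    h.le_of_periodic hg (hπ n) (hS _ n) (hS _ n) fun k => hUV _

end Grid

/-- Lemma 2: under the monotonicity conditions (18)–(19), for the solution operator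
`Φ` of the conservative implicit scheme, raising the data at exactly one grid point
produces a componentwise larger-or-equal new data set. -/
theorem implicit_scheme_single_point_comparison
    (d : ℕ) (hd : 1 ≤ d) (Δt : ℝ) (hΔt : 0 < Δt)
    (Δx : Fin d → ℝ) (hΔx : ∀ l, 0 < Δx l)
    (g : Fin d → ℝ → ℝ → ℝ) (q : (Fin d → ℤ) → ℝ)
    (e : Fin d → (Fin d → ℤ)) (he : ∀ l, e l = Pi.single l 1)
    (hmon : ∀ l : Fin d,
      (∀ a b c Δa : ℝ, 0 ≤ Δa →
        -(Δt / Δx l) * (g l b c - g l a b) ≤ -(Δt / Δx l) * (g l b c - g l (a + Δa) b)) ∧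
      (∀ a b c Δc : ℝ, 0 ≤ Δc →
        -(Δt / Δx l) * (g l b c - g l a b) ≤ -(Δt / Δx l) * (g l b (c + Δc) - g l a b)))
    (Φ : ((Fin d → ℤ) → ℝ) → ((Fin d → ℤ) → ℝ))
    (hΦ : ∀ (u : (Fin d → ℤ) → ℝ) (j : Fin d → ℤ),
      Φ u j = u j
        - (∑ l : Fin d, (Δt / Δx l) *
            (g l (Φ u j) (Φ u (j + e l)) - g l (Φ u (j - e l)) (Φ u j)))
        + Δt * q j)
    (huniq : ∀ (u U : (Fin d → ℤ) → ℝ),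
      (∀ j : Fin d → ℤ,
        U j = u j
          - (∑ l : Fin d, (Δt / Δx l) *
              (g l (U j) (U (j + e l)) - g l (U (j - e l)) (U j)))
          + Δt * q j) → U = Φ u)
    (v w : (Fin d → ℤ) → ℝ) (i : Fin d → ℤ)
    (hi : w i < v i) (hother : ∀ j : Fin d → ℤ, j ≠ i → v j = w j) :
    ∀ j : Fin d → ℤ, Φ w j ≤ Φ v j := by
  let g' : Fin d → ℝ → ℝ → ℝ := fun l a b => Δt / Δx l * g l a b
  obtain rfl : e = fun l => Pi.single l 1 := funext he
  have hg : ∀ l, IsMonotoneFlux (g' l) := by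
    refine fun l => ⟨fun b x y hxy => ?_, fun a x y hxy => ?_⟩
    · have := (hmon l).1 x b 0 (y - x) (sub_nonneg.2 hxy)
      rw [add_sub_cancel] at this
      simp only [g']
      linarith
    · have := (hmon l).2 0 a x (y - x) (sub_nonneg.2 hxy)
      rw [add_sub_cancel] at this
      simp only [g']
      linarith
  have hsum : ∀ (U : (Fin d → ℤ) → ℝ) j, scheme (fun l => Pi.single l 1) g' U j
      = U j + ∑ l, Δt / Δx l * (g l (U j) (U (j + Pi.single l 1))
        - g l (U (j - Pi.single l 1)) (U j)) := by
    intro U j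
    simp only [scheme, g', mul_sub]
  have hsol : ∀ u j, scheme (fun l => Pi.single l 1) g' (Φ u) j = u j + Δt * q j := by
    intro u j
    rw [hsum]
    linarith [hΦ u j]
  have hwp : WellPosed (fun l : Fin d => (Pi.single l 1 : Fin d → ℤ)) g' := by
    constructor
    · have key : ∀ U, U = Φ fun j => scheme (fun l => Pi.single l 1) g' U j - Δt * q j := by
        refine fun U => huniq _ U fun j => ?_
        rw [hsum]
        ring
      intro U V hUV
      rw [key U, key V, hUV]
    · refine fun z => ⟨Φ fun j => z j - Δt * q j, funext fun j => ?_⟩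
      rw [hsol]
      ring
  refine hwp.comparison hg fun j => ?_
  rw [hsol, hsol]
  by_cases hj : j = i
  · subst hj
    linarith
  · rw [hother j hj]
end

section
/- Fix a dimension d ≥ 1, a time step Δt > 0, mesh widths Δx_l > 0 (l = 1,…,d), and numerical flux functions g_l : ℝ × ℝ → ℝ, each nondecreasing in its first argument and nonincreasing in its second argument. Suppose grid functions U, u, q : ℤ^d → ℝ satisfy the implicit scheme relation: for every j ∈ ℤ^d, U_j = u_j − Σ_{l=1}^d (Δt/Δx_l)(g_l(U_j, U_{j+e_l}) − g_l(U_{j−e_l}, U_j)) + Δt·q_j. (i) If u_j ≤ b and q_j ≤ Q for all j, and U attains its supremum at some index j₀ (i.e. U_j ≤ U_{j₀} for all j), then U_j ≤ b + Δt·Q for all j. (ii) If u_j ≥ a and q_j ≥ P for all j, and U attains its infimum at some index, then U_j ≥ a + Δt·P for all j. -/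
/-- One-step maximum/minimum principle (underlying Theorem 2) for a monotone
conservative implicit scheme: (i) if the data and the source are bounded above by
`b` and `Q` and the new solution attains its supremum, then `U ≤ b + Δt·Q`;
(ii) the dual lower bound. -/
theorem implicit_scheme_max_min_principle
    (d : ℕ) (hd : 1 ≤ d) (Δt : ℝ) (hΔt : 0 < Δt)
    (Δx : Fin d → ℝ) (hΔx : ∀ l, 0 < Δx l)
    (g : Fin d → ℝ → ℝ → ℝ)
    (hg : ∀ l : Fin d,
      (∀ b : ℝ, Monotone fun a => g l a b) ∧ (∀ a : ℝ, Antitone fun c => g l a c))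
    (e : Fin d → (Fin d → ℤ)) (he : ∀ l, e l = Pi.single l 1)
    (U u q : (Fin d → ℤ) → ℝ)
    (hscheme : ∀ j : Fin d → ℤ,
      U j = u j
        - (∑ l : Fin d, (Δt / Δx l) *
            (g l (U j) (U (j + e l)) - g l (U (j - e l)) (U j)))
        + Δt * q j) :
    (∀ b Q : ℝ, (∀ j, u j ≤ b) → (∀ j, q j ≤ Q) →
      (∃ j₀, ∀ j, U j ≤ U j₀) → ∀ j, U j ≤ b + Δt * Q) ∧
    (∀ a P : ℝ, (∀ j, a ≤ u j) → (∀ j, P ≤ q j) →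
      (∃ j₁, ∀ j, U j₁ ≤ U j) → ∀ j, a + Δt * P ≤ U j) := by
  constructor
  · rintro b Q hu hq ⟨j₀, hmax⟩ j
    have hsum : 0 ≤ ∑ l : Fin d, (Δt / Δx l) *
        (g l (U j₀) (U (j₀ + e l)) - g l (U (j₀ - e l)) (U j₀)) :=
      Finset.sum_nonneg fun l _ => mul_nonneg (div_pos hΔt (hΔx l)).le <|
        sub_nonneg.mpr <| ((hg l).1 (U j₀) (hmax (j₀ - e l))).trans
          ((hg l).2 (U j₀) (hmax (j₀ + e l)))
    have hsource := mul_le_mul_of_nonneg_left (hq j₀) hΔt.le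
    linarith [hscheme j₀, hmax j, hu j₀]
  · rintro a P hu hq ⟨j₁, hmin⟩ j
    have hsum : ∑ l : Fin d, (Δt / Δx l) *
        (g l (U j₁) (U (j₁ + e l)) - g l (U (j₁ - e l)) (U j₁)) ≤ 0 :=
      Finset.sum_nonpos fun l _ => mul_nonpos_of_nonneg_of_nonpos (div_pos hΔt (hΔx l)).le <|
        sub_nonpos.mpr <| ((hg l).2 (U j₁) (hmin (j₁ + e l))).trans
          ((hg l).1 (U j₁) (hmin (j₁ - e l)))
    have hsource := mul_le_mul_of_nonneg_left (hq j₁) hΔt.le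
    linarith [hscheme j₁, hmin j, hu j₁]
end

section
/- Fix a dimension d ≥ 1, a time step Δt > 0, mesh widths Δx_l > 0 (l = 1,…,d), and numerical flux functions g_l : ℝ × ℝ → ℝ, each nondecreasing in its first argument and nonincreasing in its second argument. Let N ≥ 1, let u^0, u^1, …, u^N and q^1, …, q^N be grid functions ℤ^d → ℝ such that for each n = 1,…,N, u^n satisfies the implicit scheme relation with data u^{n−1} and source q^n (i.e. u^n_j = u^{n−1}_j − Σ_{l=1}^d (Δt/Δx_l)(g_l(u^n_j, u^n_{j+e_l}) − g_l(u^n_{j−e_l}, u^n_j)) + Δt·q^n_j for all j), each u^n attains both its supremum and its infimum over ℤ^d, and |q^n_j| ≤ Q_n for all j, with constants Q_n ≥ 0. If a ≤ u^0_j ≤ b for all j, then for every n = 0,…,N and every j ∈ ℤ^d: a − Δt·Σ_{m=1}^{n} Q_m ≤ u^n_j ≤ b + Δt·Σ_{m=1}^{n} Q_m. -/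
/-- At a maximum point of a grid function, the weighted sum of monotone flux differences
is nonnegative. -/
theorem flux_difference_sum_nonneg {ι G : Type*} [Fintype ι] [AddGroup G]
    (g : ι → ℝ → ℝ → ℝ)
    (hg : ∀ l, (∀ b : ℝ, Monotone fun a => g l a b) ∧ (∀ a : ℝ, Antitone fun c => g l a c))
    (w : ι → ℝ) (hw : ∀ l, 0 ≤ w l) (e : ι → G) (v : G → ℝ) (i : G) (hi : ∀ j, v j ≤ v i) :
    0 ≤ ∑ l, w l * (g l (v i) (v (i + e l)) - g l (v (i - e l)) (v i)) :=
  Finset.sum_nonneg fun l _ => mul_nonneg (hw l) <| sub_nonneg.mpr <|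
    ((hg l).1 (v i) (hi (i - e l))).trans ((hg l).2 (v i) (hi (i + e l)))

/-- At a minimum point of a grid function, the weighted sum of monotone flux differences
is nonpositive. -/
theorem flux_difference_sum_nonpos {ι G : Type*} [Fintype ι] [AddGroup G]
    (g : ι → ℝ → ℝ → ℝ)
    (hg : ∀ l, (∀ b : ℝ, Monotone fun a => g l a b) ∧ (∀ a : ℝ, Antitone fun c => g l a c))
    (w : ι → ℝ) (hw : ∀ l, 0 ≤ w l) (e : ι → G) (v : G → ℝ) (i : G) (hi : ∀ j, v i ≤ v j) :
    ∑ l, w l * (g l (v i) (v (i + e l)) - g l (v (i - e l)) (v i)) ≤ 0 :=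
  Finset.sum_nonpos fun l _ => mul_nonpos_of_nonneg_of_nonpos (hw l) <| sub_nonpos.mpr <|
    ((hg l).2 (v i) (hi (i + e l))).trans ((hg l).1 (v i) (hi (i - e l)))

/-- Theorem 2 (L∞-stability): a conservative monotone implicit method produces a
numerical solution bounded over finitely many time steps, the initial bounds being
shifted by the accumulated source bounds. -/
theorem implicit_scheme_Linfty_stability
    (d : ℕ) (hd : 1 ≤ d) (Δt : ℝ) (hΔt : 0 < Δt)
    (Δx : Fin d → ℝ) (hΔx : ∀ l, 0 < Δx l)
    (g : Fin d → ℝ → ℝ → ℝ)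
    (hg : ∀ l : Fin d,
      (∀ b : ℝ, Monotone fun a => g l a b) ∧ (∀ a : ℝ, Antitone fun c => g l a c))
    (e : Fin d → (Fin d → ℤ)) (he : ∀ l, e l = Pi.single l 1)
    (N : ℕ) (hN : 1 ≤ N)
    (u : ℕ → (Fin d → ℤ) → ℝ) (q : ℕ → (Fin d → ℤ) → ℝ) (Q : ℕ → ℝ)
    (hQ : ∀ n, 0 ≤ Q n)
    (hscheme : ∀ n, 1 ≤ n → n ≤ N → ∀ j : Fin d → ℤ,
      u n j = u (n - 1) j
        - (∑ l : Fin d, (Δt / Δx l) *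
            (g l (u n j) (u n (j + e l)) - g l (u n (j - e l)) (u n j)))
        + Δt * q n j)
    (hattain : ∀ n, 1 ≤ n → n ≤ N →
      (∃ j₀, ∀ j, u n j ≤ u n j₀) ∧ (∃ j₁, ∀ j, u n j₁ ≤ u n j))
    (hq : ∀ n, 1 ≤ n → n ≤ N → ∀ j, |q n j| ≤ Q n)
    (a b : ℝ) (h0 : ∀ j, a ≤ u 0 j ∧ u 0 j ≤ b) :
    ∀ n, n ≤ N → ∀ j : Fin d → ℤ,
      a - Δt * (∑ m ∈ Finset.Icc 1 n, Q m) ≤ u n j ∧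
      u n j ≤ b + Δt * (∑ m ∈ Finset.Icc 1 n, Q m) := by
  intro n
  induction n with
  | zero => intro _ j; simpa using h0 j
  | succ n ih =>
    intro hn j
    have ih := ih (by omega)
    obtain ⟨⟨j₀, hj₀⟩, j₁, hj₁⟩ := hattain (n + 1) (by omega) hn
    have hs₀ := hscheme (n + 1) (by omega) hn j₀
    have hs₁ := hscheme (n + 1) (by omega) hn j₁
    have hq₀ := mul_le_mul_of_nonneg_left
      (abs_le.mp (hq (n + 1) (by omega) hn j₀)).2 hΔt.le
    have hq₁ := mul_le_mul_of_nonneg_left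
      (abs_le.mp (hq (n + 1) (by omega) hn j₁)).1 hΔt.le
    rw [Nat.add_sub_cancel] at hs₀ hs₁
    have hw : ∀ l, 0 ≤ Δt / Δx l := fun l => (div_pos hΔt (hΔx l)).le
    have hflux₀ := flux_difference_sum_nonneg g hg _ hw e (u (n + 1)) j₀ hj₀
    have hflux₁ := flux_difference_sum_nonpos g hg _ hw e (u (n + 1)) j₁ hj₁
    rw [Finset.sum_Icc_succ_top (by omega), mul_add]
    constructor
    · linarith [hj₁ j, (ih j₁).1]
    · linarith [hj₀ j, (ih j₀).2]
end

section
/- Fix a dimension d ≥ 1, a time step Δt > 0, mesh widths Δx_l > 0 (l = 1,…,d), flux functions f_l : ℝ → ℝ, and numerical flux functions g_l : ℝ × ℝ → ℝ that are consistent (g_l(v,v) = f_l(v) for all v) and each nondecreasing in its first argument and nonincreasing in its second argument. Suppose grid functions U, u, q : ℤ^d → ℝ satisfy the implicit scheme relation: for every j ∈ ℤ^d, U_j = u_j − Σ_{l=1}^d (Δt/Δx_l)(g_l(U_j, U_{j+e_l}) − g_l(U_{j−e_l}, U_j)) + Δt·q_j. Define G_l(v,w;k) := g_l(v ∨ k,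 w ∨ k) − g_l(v ∧ k, w ∧ k). Then for every j ∈ ℤ^d and every k ∈ ℝ the discrete entropy inequality holds: (|U_j − k| − |u_j − k|)/Δt ≤ − Σ_{l=1}^d (G_l(U_j, U_{j+e_l}; k) − G_l(U_{j−e_l}, U_j; k))/Δx_l + sgn(U_j − k)·q_j, where sgn is the sign function with sgn(0) = 0. -/
/-- The difference of the Crandall–Majda entropy fluxes of a monotone flux `g` is dominated by
the difference of the fluxes themselves, weighted with the sign of `a - k`. -/
theorem entropy_flux_sub_le_sign_mul {g : ℝ → ℝ → ℝ}
    (hmono : ∀ b, Monotone fun a => g a b) (hanti : ∀ a, Antitone fun b => g a b)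
    (a b c k : ℝ) :
    (g (a ⊔ k) (b ⊔ k) - g (a ⊓ k) (b ⊓ k)) - (g (c ⊔ k) (a ⊔ k) - g (c ⊓ k) (a ⊓ k)) ≤
      Real.sign (a - k) * (g a b - g c a) := by
  have hk₁ : g k (b ⊔ k) ≤ g k k := hanti k le_sup_right
  have hk₂ : g k k ≤ g k (b ⊓ k) := hanti k inf_le_right
  have hk₃ : g k k ≤ g (c ⊔ k) k := hmono k le_sup_right
  have hk₄ : g (c ⊓ k) k ≤ g k k := hmono k inf_le_right
  have ha₁ : g a (b ⊔ k) ≤ g a b := hanti a le_sup_left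
  have ha₂ : g a b ≤ g a (b ⊓ k) := hanti a inf_le_left
  have ha₃ : g c a ≤ g (c ⊔ k) a := hmono a le_sup_left
  have ha₄ : g (c ⊓ k) a ≤ g c a := hmono a inf_le_left
  rcases lt_trichotomy a k with h | rfl | h
  · rw [Real.sign_of_neg (sub_neg.2 h), sup_eq_right.2 h.le, inf_eq_left.2 h.le]
    linarith
  · rw [sub_self, Real.sign_zero, sup_idem, inf_idem]
    linarith
  · rw [Real.sign_of_pos (sub_pos.2 h), sup_eq_left.2 h.le, inf_eq_right.2 h.le]
    linarith

theorem Real.sign_mul_le_abs (x y : ℝ) : Real.sign x * y ≤ |y| := by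
  rcases Real.sign_apply_eq x with h | h | h <;> rw [h]
  · simpa using neg_le_abs y
  · simp
  · simpa using le_abs_self y

theorem Real.sign_mul_self_eq_abs (x : ℝ) : Real.sign x * x = |x| := by
  rcases lt_trichotomy x 0 with h | rfl | h
  · rw [Real.sign_of_neg h, abs_of_neg h, neg_one_mul]
  · simp
  · rw [Real.sign_of_pos h, abs_of_pos h, one_mul]


/-- Theorem 3: a consistent, conservative, monotone implicit scheme satisfies the
discrete entropy inequality (21) with the Kružkov entropy `|·−k|` and the
Crandall–Majda numerical entropy fluxes
`G_l(v,w;k) = g_l(v ∨ k, w ∨ k) − g_l(v ∧ k, w ∧ k)`. -/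
theorem implicit_scheme_discrete_entropy_inequality
    (d : ℕ) (hd : 1 ≤ d) (Δt : ℝ) (hΔt : 0 < Δt)
    (Δx : Fin d → ℝ) (hΔx : ∀ l, 0 < Δx l)
    (f : Fin d → ℝ → ℝ) (g : Fin d → ℝ → ℝ → ℝ)
    (hcons : ∀ l : Fin d, ∀ v : ℝ, g l v v = f l v)
    (hg : ∀ l : Fin d,
      (∀ b : ℝ, Monotone fun a => g l a b) ∧ (∀ a : ℝ, Antitone fun c => g l a c))
    (e : Fin d → (Fin d → ℤ)) (he : ∀ l, e l = Pi.single l 1)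
    (U u q : (Fin d → ℤ) → ℝ)
    (hscheme : ∀ j : Fin d → ℤ,
      U j = u j
        - (∑ l : Fin d, (Δt / Δx l) *
            (g l (U j) (U (j + e l)) - g l (U (j - e l)) (U j)))
        + Δt * q j)
    (G : Fin d → ℝ → ℝ → ℝ → ℝ)
    (hG : ∀ l : Fin d, ∀ v w k : ℝ,
      G l v w k = g l (v ⊔ k) (w ⊔ k) - g l (v ⊓ k) (w ⊓ k)) :
    ∀ (j : Fin d → ℤ) (k : ℝ),
      (|U j - k| - |u j - k|) / Δt ≤
        -(∑ l : Fin d,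
            (G l (U j) (U (j + e l)) k - G l (U (j - e l)) (U j) k) / Δx l)
          + Real.sign (U j - k) * q j := by
  intro j k
  have hflux : ∑ l, (G l (U j) (U (j + e l)) k - G l (U (j - e l)) (U j) k) / Δx l ≤
      Real.sign (U j - k) * ∑ l, (g l (U j) (U (j + e l)) - g l (U (j - e l)) (U j)) / Δx l := by
    rw [Finset.mul_sum]
    refine Finset.sum_le_sum fun l _ => ?_
    rw [hG, hG, ← mul_div_assoc]
    exact div_le_div_of_nonneg_right
      (entropy_flux_sub_le_sign_mul (hg l).1 (hg l).2 _ _ _ _) (hΔx l).le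
  have hstep : U j - k = (u j - k)
      - Δt * ∑ l, (g l (U j) (U (j + e l)) - g l (U (j - e l)) (U j)) / Δx l + Δt * q j := by
    have hsum : ∑ l, Δt / Δx l * (g l (U j) (U (j + e l)) - g l (U (j - e l)) (U j)) =
        Δt * ∑ l, (g l (U j) (U (j + e l)) - g l (U (j - e l)) (U j)) / Δx l := by
      rw [Finset.mul_sum]
      exact Finset.sum_congr rfl fun l _ => by ring
    linarith [hscheme j]
  have habs := Real.sign_mul_self_eq_abs (U j - k)
  have hle := Real.sign_mul_le_abs (U j - k) (u j - k)
  have hscaled := mul_le_mul_of_nonneg_left hflux hΔt.le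
  rw [div_le_iff₀ hΔt]
  generalize Real.sign (U j - k) = s at *
  rw [← habs, hstep]
  linarith
end

section
/- Fix a dimension d ≥ 1, a time step Δt > 0, mesh widths Δx_l > 0 (l = 1,…,d), and numerical flux functions g_l : ℝ × ℝ → ℝ, each nondecreasing in its first argument and nonincreasing in its second argument. Suppose grid functions U, u, q : ℤ^d → ℝ satisfy the implicit scheme relation: for every j ∈ ℤ^d, U_j = u_j − Σ_{l=1}^d (Δt/Δx_l)(g_l(U_j, U_{j+e_l}) − g_l(U_{j−e_l}, U_j)) + Δt·q_j. Fix j ∈ ℤ^d, k ∈ ℝ, and set H∨ := (u_j ∨ k) − Σ_{l=1}^d (Δt/Δx_l)(g_l(U_j ∨ k, U_{j+e_l} ∨ k) − g_l(U_{j−e_l} ∨ k, U_j ∨ k)) + Δt·q_j. Then: (a) if U_j ≥ k then H∨ ≥ U_j ∨ k, and (b) if U_j ≤ k then H∨ ≥ k + Δt·q_j. -/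
/-- Cases (a) and (b) in the proof of Theorem 3 (upper, max-truncation estimate):
applying the scheme's increment function to the data truncated from below at level
`k` dominates the truncated updated value. -/
theorem implicit_scheme_max_truncation_estimate
    (d : ℕ) (hd : 1 ≤ d) (Δt : ℝ) (hΔt : 0 < Δt)
    (Δx : Fin d → ℝ) (hΔx : ∀ l, 0 < Δx l)
    (g : Fin d → ℝ → ℝ → ℝ)
    (hg : ∀ l : Fin d,
      (∀ b : ℝ, Monotone fun a => g l a b) ∧ (∀ a : ℝ, Antitone fun c => g l a c))
    (e : Fin d → (Fin d → ℤ)) (he : ∀ l, e l = Pi.single l 1)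
    (U u q : (Fin d → ℤ) → ℝ)
    (hscheme : ∀ j : Fin d → ℤ,
      U j = u j
        - (∑ l : Fin d, (Δt / Δx l) *
            (g l (U j) (U (j + e l)) - g l (U (j - e l)) (U j)))
        + Δt * q j)
    (j : Fin d → ℤ) (k : ℝ) (Hvee : ℝ)
    (hHvee : Hvee = (u j ⊔ k)
        - (∑ l : Fin d, (Δt / Δx l) *
            (g l (U j ⊔ k) (U (j + e l) ⊔ k) - g l (U (j - e l) ⊔ k) (U j ⊔ k)))
        + Δt * q j) :
    (k ≤ U j → U j ⊔ k ≤ Hvee) ∧ (U j ≤ k → k + Δt * q j ≤ Hvee) := by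
  have hc : ∀ l, 0 ≤ Δt / Δx l := fun l => (div_pos hΔt (hΔx l)).le
  subst hHvee
  constructor
  · intro hk
    have hsum : ∑ l : Fin d, (Δt / Δx l) *
          (g l (U j) (U (j + e l) ⊔ k) - g l (U (j - e l) ⊔ k) (U j)) ≤
        ∑ l : Fin d, (Δt / Δx l) * (g l (U j) (U (j + e l)) - g l (U (j - e l)) (U j)) :=
      Finset.sum_le_sum fun l _ => mul_le_mul_of_nonneg_left
        (sub_le_sub ((hg l).2 _ le_sup_left) ((hg l).1 _ le_sup_left)) (hc l)
    rw [sup_eq_left.2 hk]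
    linarith [hscheme j, le_sup_left (a := u j) (b := k)]
  · intro hk
    have hsum : ∑ l : Fin d, (Δt / Δx l) *
          (g l k (U (j + e l) ⊔ k) - g l (U (j - e l) ⊔ k) k) ≤ 0 :=
      Finset.sum_nonpos fun l _ => mul_nonpos_of_nonneg_of_nonpos (hc l) <|
        sub_nonpos.2 <| ((hg l).2 k le_sup_right).trans ((hg l).1 k le_sup_right)
    rw [sup_eq_right.2 hk]
    linarith [le_sup_right (a := u j) (b := k)]
end

section
/- Fix a dimension d ≥ 1, a time step Δt > 0, mesh widths Δx_l > 0 (l = 1,…,d), and numerical flux functions g_l : ℝ × ℝ → ℝ, each nondecreasing in its first argument and nonincreasing in its second argument. Suppose grid functions U, u, q : ℤ^d → ℝ satisfy the implicit scheme relation: for every j ∈ ℤ^d, U_j = u_j − Σ_{l=1}^d (Δt/Δx_l)(g_l(U_j, U_{j+e_l}) − g_l(U_{j−e_l}, U_j)) + Δt·q_j. Fix j ∈ ℤ^d, k ∈ ℝ, and set H∧ := (u_j ∧ k) − Σ_{l=1}^d (Δt/Δx_l)(g_l(U_j ∧ k, U_{j+e_l} ∧ k) − g_l(U_{j−e_l}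 ∧ k, U_j ∧ k)) + Δt·q_j. Then: (c) if U_j ≥ k then H∧ ≤ k + Δt·q_j, and (d) if U_j ≤ k then H∧ ≤ U_j ∧ k. -/
/-- Cases (c) and (d) in the proof of Theorem 3 (lower, min-truncation estimate):
applying the scheme's increment function to the data truncated from above at level
`k` is dominated by the truncated updated value. -/
theorem implicit_scheme_min_truncation_estimate
    (d : ℕ) (hd : 1 ≤ d) (Δt : ℝ) (hΔt : 0 < Δt)
    (Δx : Fin d → ℝ) (hΔx : ∀ l, 0 < Δx l)
    (g : Fin d → ℝ → ℝ → ℝ)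
    (hg : ∀ l : Fin d,
      (∀ b : ℝ, Monotone fun a => g l a b) ∧ (∀ a : ℝ, Antitone fun c => g l a c))
    (e : Fin d → (Fin d → ℤ)) (he : ∀ l, e l = Pi.single l 1)
    (U u q : (Fin d → ℤ) → ℝ)
    (hscheme : ∀ j : Fin d → ℤ,
      U j = u j
        - (∑ l : Fin d, (Δt / Δx l) *
            (g l (U j) (U (j + e l)) - g l (U (j - e l)) (U j)))
        + Δt * q j)
    (j : Fin d → ℤ) (k : ℝ) (Hwedge : ℝ)
    (hHwedge : Hwedge = (u j ⊓ k)
        - (∑ l : Fin d, (Δt / Δx l) *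
            (g l (U j ⊓ k) (U (j + e l) ⊓ k) - g l (U (j - e l) ⊓ k) (U j ⊓ k)))
        + Δt * q j) :
    (k ≤ U j → Hwedge ≤ k + Δt * q j) ∧ (U j ≤ k → Hwedge ≤ U j ⊓ k) := by
  have hw : ∀ l, 0 ≤ Δt / Δx l := fun l => (div_pos hΔt (hΔx l)).le
  constructor
  · intro hk
    rw [inf_eq_right.mpr hk] at hHwedge
    have hsum : 0 ≤ ∑ l : Fin d, (Δt / Δx l) *
        (g l k (U (j + e l) ⊓ k) - g l (U (j - e l) ⊓ k) k) := by
      refine Finset.sum_nonneg fun l _ => mul_nonneg (hw l) (sub_nonneg.mpr ?_)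
      exact ((hg l).1 k inf_le_right).trans ((hg l).2 k inf_le_right)
    have := inf_le_right (a := u j) (b := k)
    linarith
  · intro hk
    rw [inf_eq_left.mpr hk] at hHwedge ⊢
    have hsum : ∑ l : Fin d, (Δt / Δx l) *
          (g l (U j) (U (j + e l)) - g l (U (j - e l)) (U j)) ≤
        ∑ l : Fin d, (Δt / Δx l) *
          (g l (U j) (U (j + e l) ⊓ k) - g l (U (j - e l) ⊓ k) (U j)) := by
      refine Finset.sum_le_sum fun l _ => mul_le_mul_of_nonneg_left ?_ (hw l)
      exact sub_le_sub ((hg l).2 (U j) inf_le_left) ((hg l).1 (U j) inf_le_left)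
    have := inf_le_left (a := u j) (b := k)
    linarith [hscheme j]
end

section
/- Fix a dimension d ≥ 1, a time step Δt > 0, mesh widths Δx_l > 0 (l = 1,…,d), and flux functions f_l : ℝ → ℝ. For the implicit Lax–Friedrichs method u_j^{n+1} = u_j^n + Σ_{l=1}^d { (1/2)(u_{j−e_l}^{n+1} − 2u_j^{n+1} + u_{j+e_l}^{n+1}) − (Δt/(2Δx_l))(f_l(u_{j+e_l}^{n+1}) − f_l(u_{j−e_l}^{n+1})) }, whose increment functions are Ĥ_l(a,b,c) = (1/2)(a − 2b + c) − (Δt/(2Δx_l))(f_l(c) − f_l(a)), the monotonicity conditions (18)–(19) hold for every l ∈ {1,…,d} if and only if for every l and all x ≤ y one has |f_l(y) − f_l(x)| ≤ (Δx_l/Δt)·(y − x); that is, the implicit Lax–Friedrichs scheme is monotone if and only if each flux f_l is Lipschitz continuous with Lipschitz constant at most Δx_l/Δt. In particular, the restriction on the admissible Lipschitz constant does not depend on the number of spatial dimensions d. -/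
theorem abs_le_div_mul_iff_scaled {t X : ℝ} (ht : 0 < t) (hX : 0 < X) (D h : ℝ) :
    |D| ≤ X / t * h ↔ -(h / 2) ≤ t / (2 * X) * D ∧ t / (2 * X) * D ≤ h / 2 := by
  have hk : 0 < t / (2 * X) := by positivity
  have hh : t / (2 * X) * (X / t * h) = h / 2 := by field_simp
  rw [← abs_le, abs_mul, abs_of_pos hk, ← hh, mul_le_mul_iff_right₀ hk]

/-- Section 4.2: the implicit Lax–Friedrichs method, with increment functions
`Ĥ_l(a,b,c) = (1/2)(a − 2b + c) − (Δt/(2Δx_l))(f_l(c) − f_l(a))`, satisfies the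
monotonicity conditions (18)–(19) for every `l` iff each flux `f_l` is Lipschitz
continuous with Lipschitz constant at most `Δx_l/Δt`. -/
theorem implicit_LaxFriedrichs_monotone_iff_Lipschitz
    (d : ℕ) (hd : 1 ≤ d) (Δt : ℝ) (hΔt : 0 < Δt)
    (Δx : Fin d → ℝ) (hΔx : ∀ l, 0 < Δx l)
    (f : Fin d → ℝ → ℝ)
    (H : Fin d → ℝ → ℝ → ℝ → ℝ)
    (hH : ∀ l a b c, H l a b c =
      (1 / 2) * (a - 2 * b + c) - (Δt / (2 * Δx l)) * (f l c - f l a)) :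
    ((∀ l : Fin d, ∀ a b c Δa : ℝ, 0 ≤ Δa → H l a b c ≤ H l (a + Δa) b c) ∧
      (∀ l : Fin d, ∀ a b c Δc : ℝ, 0 ≤ Δc → H l a b c ≤ H l a b (c + Δc))) ↔
    (∀ l : Fin d, ∀ x y : ℝ, x ≤ y → |f l y - f l x| ≤ (Δx l / Δt) * (y - x)) := by
  have key (l : Fin d) (x y : ℝ) := abs_le_div_mul_iff_scaled hΔt (hΔx l) (f l y - f l x) (y - x)
  simp only [key, hH]
  constructor
  · rintro ⟨ha, hc⟩ l x y hxy
    have h₁ := ha l x 0 0 (y - x) (by linarith)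
    have h₂ := hc l 0 0 x (y - x) (by linarith)
    rw [add_sub_cancel] at h₁ h₂
    constructor <;> linarith
  · intro h
    constructor
    · intro l a b c δ hδ
      have := (h l a (a + δ) (by linarith)).1
      linarith
    · intro l a b c δ hδ
      have := (h l c (c + δ) (by linarith)).2
      linarith
end

section
/- Let f : ℝ → ℝ be continuous and define the Godunov numerical flux g^G : ℝ × ℝ → ℝ by g^G(v,w) = min_{v ≤ u ≤ w} f(u) (the infimum of f on the closed interval [v,w], attained by continuity) if v ≤ w, and g^G(v,w) = max_{w ≤ u ≤ v} f(u) if v > w. Then g^G is nondecreasing in its first argument and nonincreasing in its second argument: for all a ≤ a' and all b, g^G(a', b) ≥ g^G(a, b), and for all c ≤ c' and all b, g^G(b, c') ≤ g^G(b, c). Consequently the implicit Godunov-type scheme built from g^G satisfies the monotonicity conditions (18)–(19) for arbitrary continuous flux functions, without any Lipschitz condition. -/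
theorem Continuous.bddBelow_image_Icc {f : ℝ → ℝ} (hf : Continuous f) (v w : ℝ) :
    BddBelow (f '' Set.Icc v w) :=
  isCompact_Icc.bddBelow_image hf.continuousOn

theorem Continuous.bddAbove_image_Icc {f : ℝ → ℝ} (hf : Continuous f) (v w : ℝ) :
    BddAbove (f '' Set.Icc v w) :=
  isCompact_Icc.bddAbove_image hf.continuousOn

theorem Continuous.sInf_image_Icc_le {f : ℝ → ℝ} (hf : Continuous f) {u v w : ℝ}
    (hu : u ∈ Set.Icc v w) : sInf (f '' Set.Icc v w) ≤ f u :=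
  csInf_le (hf.bddBelow_image_Icc v w) (Set.mem_image_of_mem f hu)

theorem Continuous.le_sSup_image_Icc {f : ℝ → ℝ} (hf : Continuous f) {u v w : ℝ}
    (hu : u ∈ Set.Icc v w) : f u ≤ sSup (f '' Set.Icc v w) :=
  le_csSup (hf.bddAbove_image_Icc v w) (Set.mem_image_of_mem f hu)

theorem Continuous.sInf_image_Icc_anti {f : ℝ → ℝ} (hf : Continuous f) {v w v' w' : ℝ}
    (hv : v ≤ v') (hw : w' ≤ w) (h : v' ≤ w') :
    sInf (f '' Set.Icc v w) ≤ sInf (f '' Set.Icc v' w') :=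
  csInf_le_csInf (hf.bddBelow_image_Icc v w) ((Set.nonempty_Icc.2 h).image f)
    (Set.image_mono (Set.Icc_subset_Icc hv hw))

theorem Continuous.sSup_image_Icc_mono {f : ℝ → ℝ} (hf : Continuous f) {v w v' w' : ℝ}
    (hv : v ≤ v') (hw : w' ≤ w) (h : v' ≤ w') :
    sSup (f '' Set.Icc v' w') ≤ sSup (f '' Set.Icc v w) :=
  csSup_le_csSup (hf.bddAbove_image_Icc v w) ((Set.nonempty_Icc.2 h).image f)
    (Set.image_mono (Set.Icc_subset_Icc hv hw))

/-- Section 4.3: for a continuous flux `f`, the Godunov numerical flux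
`g^G(v,w) = min_{v ≤ u ≤ w} f(u)` if `v ≤ w`, `g^G(v,w) = max_{w ≤ u ≤ v} f(u)` if
`v > w`, is nondecreasing in its first argument and nonincreasing in its second
argument; consequently the implicit Godunov-type scheme satisfies the monotonicity
conditions (18)–(19) for arbitrary continuous fluxes, without any Lipschitz
condition. -/
theorem godunov_flux_monotone
    (f : ℝ → ℝ) (hf : Continuous f)
    (gG : ℝ → ℝ → ℝ)
    (hgG : ∀ v w : ℝ, gG v w =
      if v ≤ w then sInf (f '' Set.Icc v w) else sSup (f '' Set.Icc w v)) :
    (∀ b : ℝ, Monotone fun a => gG a b) ∧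
    (∀ a : ℝ, Antitone fun c => gG a c) ∧
    (∀ Δt Δx : ℝ, 0 < Δt → 0 < Δx →
      (∀ a b c Δa : ℝ, 0 ≤ Δa →
        -(Δt / Δx) * (gG b c - gG a b) ≤ -(Δt / Δx) * (gG b c - gG (a + Δa) b)) ∧
      (∀ a b c Δc : ℝ, 0 ≤ Δc →
        -(Δt / Δx) * (gG b c - gG a b) ≤ -(Δt / Δx) * (gG b (c + Δc) - gG a b))) := by
  have hmono : ∀ b : ℝ, Monotone fun a => gG a b := by
    intro b a a' h
    simp only [hgG]
    split_ifs with hab ha'b ha'b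
    · exact hf.sInf_image_Icc_anti h le_rfl ha'b
    · exact (hf.sInf_image_Icc_le (Set.right_mem_Icc.2 hab)).trans
        (hf.le_sSup_image_Icc (Set.left_mem_Icc.2 (not_le.1 ha'b).le))
    · exact absurd (h.trans ha'b) hab
    · exact hf.sSup_image_Icc_mono le_rfl h (not_le.1 hab).le
  have hanti : ∀ a : ℝ, Antitone fun c => gG a c := by
    intro a c c' h
    simp only [hgG]
    split_ifs with hac' hac hac
    · exact hf.sInf_image_Icc_anti le_rfl h hac
    · exact (hf.sInf_image_Icc_le (Set.left_mem_Icc.2 hac')).trans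
        (hf.le_sSup_image_Icc (Set.right_mem_Icc.2 (not_le.1 hac).le))
    · exact absurd (hac.trans h) hac'
    · exact hf.sSup_image_Icc_mono h le_rfl (not_le.1 hac').le
  refine ⟨hmono, hanti, fun Δt Δx ht hx => ?_⟩
  have hneg : -(Δt / Δx) ≤ 0 := neg_nonpos.2 (div_pos ht hx).le
  refine ⟨fun a b c Δa ha => ?_, fun a b c Δc hc => ?_⟩
  · exact mul_le_mul_of_nonpos_left
      (sub_le_sub_left (hmono b (le_add_of_nonneg_right ha)) _) hneg
  · exact mul_le_mul_of_nonpos_left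
      (sub_le_sub_right (hanti b (le_add_of_nonneg_right hc)) _) hneg
end
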